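/- (Ruhe's trace inequality) Let U and V be k×k positive semidefinite Hermitian matrices with eigenvalues λ_1(U) ≥ λ_2(U) ≥ ... ≥ λ_k(U) and λ_1(V) ≥ λ_2(V) ≥ ... ≥ λ_k(V), each listed in decreasing order with multiplicity. Then Tr(U V) ≤ Σ_{i=1}^{k} λ_i(U) λ_i(V). -/

import Mathlib

open scoped ComplexOrder

open Matrix in
lemma dotProduct_mulVec_le_of_mem_doublyStochastic {n : Type*} [Fintype n] [DecidableEq n]
    {M : Matrix n n ℝ} (hM : M ∈ doublyStochastic ℝ n) {f g : n → ℝ} (hfg : Monovary f g) :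
    f ⬝ᵥ (M *ᵥ g) ≤ f ⬝ᵥ g := by
  obtain ⟨w, hw0, hw1, rfl⟩ := exists_eq_sum_perm_of_mem_doublyStochastic hM
  calc f ⬝ᵥ ((∑ σ, w σ • σ.permMatrix ℝ) *ᵥ g)
      = ∑ σ : Equiv.Perm n, w σ * (f ⬝ᵥ (g ∘ σ)) := by
        simp [Matrix.sum_mulVec, dotProduct_sum, smul_mulVec, permMatrix_mulVec]
    _ ≤ ∑ σ, w σ * (f ⬝ᵥ g) := by
        gcongr with σ
        · exact hw0 σ
        · exact hfg.sum_mul_comp_perm_le_sum_mul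
    _ = f ⬝ᵥ g := by rw [← Finset.sum_mul, hw1, one_mul]

lemma Matrix.normSq_mem_doublyStochastic {n : Type*} [Fintype n] [DecidableEq n]
    {W : Matrix n n ℂ} (hW : W ∈ Matrix.unitaryGroup n ℂ) :
    W.map Complex.normSq ∈ doublyStochastic ℝ n := by
  refine mem_doublyStochastic_iff_sum.mpr ⟨fun i j => Complex.normSq_nonneg _, fun i => ?_,
    fun j => ?_⟩
  · have h := congrFun₂ (Matrix.mem_unitaryGroup_iff.mp hW) i i
    simp only [Matrix.mul_apply, Matrix.star_apply, Matrix.one_apply_eq, Complex.star_def,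
      Complex.mul_conj] at h
    exact_mod_cast h
  · have h := congrFun₂ (Matrix.mem_unitaryGroup_iff'.mp hW) j j
    simp only [Matrix.mul_apply, Matrix.star_apply, Matrix.one_apply_eq, Complex.star_def,
      ← Complex.normSq_eq_conj_mul_self] at h
    exact_mod_cast h

open Matrix in
lemma Matrix.IsHermitian.trace_mul_eq {n : Type*} [Fintype n] [DecidableEq n]
    {A B : Matrix n n ℂ} (hA : A.IsHermitian) (hB : B.IsHermitian) :
    (A * B).trace = ((∑ i, ∑ j, hA.eigenvalues i *
      (Complex.normSq ((star hA.eigenvectorUnitary * hB.eigenvectorUnitary :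
        Matrix.unitaryGroup n ℂ).1 i j) * hB.eigenvalues j) : ℝ) : ℂ) := by
  set P := hA.eigenvectorUnitary with hP
  set Q := hB.eigenvectorUnitary with hQ
  set W : Matrix.unitaryGroup n ℂ := star P * Q with hW
  have hWc : (W : Matrix n n ℂ) = star (P : Matrix n n ℂ) * Q := rfl
  calc (A * B).trace
      = (diagonal (RCLike.ofReal ∘ hA.eigenvalues) * ((W : Matrix n n ℂ) *
          diagonal (RCLike.ofReal ∘ hB.eigenvalues) * star (W : Matrix n n ℂ))).trace := by
        conv_lhs => rw [hA.spectral_theorem, hB.spectral_theorem]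
        rw [Unitary.conjStarAlgAut_apply, Unitary.conjStarAlgAut_apply, ← hP, ← hQ, hWc,
          star_mul, star_star, mul_assoc, mul_assoc, trace_mul_comm]
        simp only [mul_assoc]
    _ = _ := by
        simp only [trace, diag, diagonal_mul, Matrix.mul_apply (N := star _), mul_diagonal,
          star_apply, Finset.mul_sum, Function.comp_apply]
        push_cast
        refine Finset.sum_congr rfl fun i _ => Finset.sum_congr rfl fun j _ => ?_
        rw [← Complex.mul_conj]
        simp only [RCLike.star_def, Complex.coe_algebraMap]
        ring

/-- **Ruhe's trace inequality.** If `U` and `V` are `k × k`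
positive semidefinite Hermitian matrices with eigenvalues `lamU` and `lamV`,
each listed in decreasing order with multiplicity, then
`Tr(U V) ≤ ∑ i, lamU i * lamV i`. -/
theorem ruhe_trace_inequality {k : ℕ} (U V : Matrix (Fin k) (Fin k) ℂ)
    (hU : U.PosSemidef) (hV : V.PosSemidef)
    (lamU lamV : Fin k → ℝ) (hlamUmono : Antitone lamU) (hlamVmono : Antitone lamV)
    (eU eV : Fin k ≃ Fin k)
    (hlamU : ∀ i, lamU i = hU.isHermitian.eigenvalues (eU i))
    (hlamV : ∀ i, lamV i = hV.isHermitian.eigenvalues (eV i)) :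
    (U * V).trace ≤ ((∑ i, lamU i * lamV i : ℝ) : ℂ) := by
  rw [hU.isHermitian.trace_mul_eq hV.isHermitian, Complex.real_le_real]
  set W := star hU.isHermitian.eigenvectorUnitary * hV.isHermitian.eigenvectorUnitary
  have hM := mem_doublyStochastic_iff_sum.mp (Matrix.normSq_mem_doublyStochastic W.2)
  have hM' : (W.1.map Complex.normSq).submatrix eU eV ∈ doublyStochastic ℝ (Fin k) :=
    mem_doublyStochastic_iff_sum.mpr ⟨fun i j => hM.1 _ _,
      fun i => (Equiv.sum_comp eV _).trans (hM.2.1 (eU i)),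
      fun j => (Equiv.sum_comp eU fun i => W.1.map Complex.normSq i (eV j)).trans
        (hM.2.2 (eV j))⟩
  refine le_of_eq_of_le ?_
    (dotProduct_mulVec_le_of_mem_doublyStochastic hM' (hlamUmono.monovary hlamVmono))
  simp only [dotProduct, Matrix.mulVec, Matrix.submatrix_apply, Matrix.map_apply, hlamU, hlamV,
    ← Finset.mul_sum]
  rw [← Equiv.sum_comp eU]
  refine Finset.sum_congr rfl fun i _ => ?_
  rw [← Equiv.sum_comp eV]
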